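/- Let ξ₁ = Σ_{k=1}^∞ 10^{−(2k−1)!} and ξ₂ = Σ_{k=1}^∞ 10^{−(2k)!}. Then φ̲₁ = −2, φ̲₂ = −1/2, φ̲₃ = 1, φ̄₁ = −1/2, φ̄₂ = 1, and φ̄₃ = 1. -/

import Mathlib

open Filter Pointwise

/-- The lattice `Λ = {(x, ξ₁x - y₁, ξ₂x - y₂) : x, y₁, y₂ ∈ ℤ} ⊆ ℝ³`. -/
def LatticeSet (ξ₁ ξ₂ : ℝ) : Set (Fin 3 → ℝ) :=
  {p | ∃ x y₁ y₂ : ℤ, p 0 = (x : ℝ) ∧ p 1 = ξ₁ * x - y₁ ∧ p 2 = ξ₂ * x - y₂}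

/-- The box `K(q) = {(z₀,z₁,z₂) : |z₀| ≤ e^{2q}, |z₁| ≤ e^{-q}, |z₂| ≤ e^{-q}}`. -/
def Box (q : ℝ) : Set (Fin 3 → ℝ) :=
  {z | |z 0| ≤ Real.exp (2 * q) ∧ |z 1| ≤ Real.exp (-q) ∧ |z 2| ≤ Real.exp (-q)}

/-- The `j`-th successive minimum `λ_j(q)` of `K(q)` with respect to `Λ`:
the infimum of all `λ > 0` such that `λ·K(q)` contains `j` linearly independent
points of `Λ`. -/
noncomputable def lambdaMin (ξ₁ ξ₂ : ℝ) (j : ℕ) (q : ℝ) : ℝ :=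
  sInf {l : ℝ | 0 < l ∧ ∃ v : Fin j → (Fin 3 → ℝ), LinearIndependent ℝ v ∧
    ∀ i, v i ∈ LatticeSet ξ₁ ξ₂ ∧ v i ∈ l • Box q}

/-- `L_j(q) = log λ_j(q)`. -/
noncomputable def Lmin (ξ₁ ξ₂ : ℝ) (j : ℕ) (q : ℝ) : ℝ :=
  Real.log (lambdaMin ξ₁ ξ₂ j q)

/-- `φ̲_j = liminf_{q → ∞} L_j(q)/q`. -/
noncomputable def phiLow (ξ₁ ξ₂ : ℝ) (j : ℕ) : ℝ :=
  liminf (fun q : ℝ => Lmin ξ₁ ξ₂ j q / q) atTop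

/-- `φ̄_j = limsup_{q → ∞} L_j(q)/q`. -/
noncomputable def phiUp (ξ₁ ξ₂ : ℝ) (j : ℕ) : ℝ :=
  limsup (fun q : ℝ => Lmin ξ₁ ξ₂ j q / q) atTop

/-- The set of dilation factors whose infimum is the `j`-th successive minimum. -/
def dilationSet (ξ₁ ξ₂ : ℝ) (j : ℕ) (q : ℝ) : Set ℝ :=
  {l : ℝ | 0 < l ∧ ∃ v : Fin j → (Fin 3 → ℝ), LinearIndependent ℝ v ∧
    ∀ i, v i ∈ LatticeSet ξ₁ ξ₂ ∧ v i ∈ l • Box q}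

lemma mem_smul_Box {l q : ℝ} (hl : 0 < l) {z : Fin 3 → ℝ} :
    z ∈ l • Box q ↔ |z 0| ≤ l * Real.exp (2 * q) ∧ |z 1| ≤ l * Real.exp (-q) ∧
      |z 2| ≤ l * Real.exp (-q) := by
  rw [Set.mem_smul_set_iff_inv_smul_mem₀ hl.ne']
  simp only [Box, Set.mem_ofPred_eq, Pi.smul_apply, smul_eq_mul, abs_mul, abs_inv,
    abs_of_pos hl, inv_mul_le_iff₀ hl]

lemma smul_Box_mono {l m q : ℝ} (hl : 0 < l) (hlm : l ≤ m) {z : Fin 3 → ℝ}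
    (hz : z ∈ l • Box q) : z ∈ m • Box q := by
  rw [mem_smul_Box hl] at hz
  rw [mem_smul_Box (hl.trans_le hlm)]
  have h : ∀ t : ℝ, l * Real.exp t ≤ m * Real.exp t := fun t => by gcongr
  exact ⟨hz.1.trans (h _), hz.2.1.trans (h _), hz.2.2.trans (h _)⟩

lemma dilationSet_succ_subset (ξ₁ ξ₂ : ℝ) (j : ℕ) (q : ℝ) :
    dilationSet ξ₁ ξ₂ (j + 1) q ⊆ dilationSet ξ₁ ξ₂ j q := by
  rintro l ⟨hl, v, hv, hm⟩
  exact ⟨hl, v ∘ Fin.castSucc, hv.comp _ (Fin.castSucc_injective j), fun i => hm _⟩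

lemma exp_le_of_mem_smul_Box {ξ₁ ξ₂ l q : ℝ} (hq : 0 ≤ q) (hl : 0 < l) {z : Fin 3 → ℝ}
    (hz : z ≠ 0) (hzΛ : z ∈ LatticeSet ξ₁ ξ₂) (hzK : z ∈ l • Box q) :
    Real.exp (-2 * q) ≤ l := by
  obtain ⟨x, y₁, y₂, h0, h1, h2⟩ := hzΛ
  obtain ⟨b0, b1, b2⟩ := (mem_smul_Box hl).1 hzK
  have key : ∀ t : ℝ, t ≤ 2 * q → 1 ≤ l * Real.exp t → Real.exp (-2 * q) ≤ l := by
    intro t ht h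
    have h' : l * Real.exp t ≤ l * Real.exp (2 * q) := by gcongr
    rw [neg_mul, Real.exp_neg, inv_le_iff_one_le_mul₀ (Real.exp_pos _)]
    linarith
  have one_le : ∀ n : ℤ, n ≠ 0 → (1 : ℝ) ≤ |(n : ℝ)| := fun n hn => by
    exact_mod_cast Int.one_le_abs hn
  by_cases hx : x = 0
  · subst hx
    by_cases hy1 : y₁ = 0
    · have hy2 : y₂ ≠ 0 := by
        rintro rfl
        apply hz
        ext i
        fin_cases i <;> simp [h0, h1, h2, hy1]
      refine key (-q) (by linarith) ((one_le y₂ hy2).trans ?_)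
      simpa [h2] using b2
    · refine key (-q) (by linarith) ((one_le y₁ hy1).trans ?_)
      simpa [h1] using b1
  · refine key (2 * q) le_rfl ((one_le x hx).trans ?_)
    rwa [h0] at b0

lemma exp_le_of_mem_dilationSet {ξ₁ ξ₂ l q : ℝ} {j : ℕ} (hq : 0 ≤ q)
    (hl : l ∈ dilationSet ξ₁ ξ₂ (j + 1) q) : Real.exp (-2 * q) ≤ l := by
  obtain ⟨hl, v, hv, hm⟩ := hl
  exact exp_le_of_mem_smul_Box hq hl (hv.ne_zero 0) (hm 0).1 (hm 0).2

lemma bddBelow_dilationSet (ξ₁ ξ₂ : ℝ) (j : ℕ) (q : ℝ) : BddBelow (dilationSet ξ₁ ξ₂ j q) :=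
  ⟨0, fun _ h => h.1.le⟩

lemma exp_le_lambdaMin {ξ₁ ξ₂ q : ℝ} {j : ℕ} (hq : 0 ≤ q)
    (hne : (dilationSet ξ₁ ξ₂ (j + 1) q).Nonempty) :
    Real.exp (-2 * q) ≤ lambdaMin ξ₁ ξ₂ (j + 1) q :=
  le_csInf hne fun _ hl => exp_le_of_mem_dilationSet hq hl

lemma Lmin_le_of_exp_mem {ξ₁ ξ₂ q t : ℝ} {j : ℕ} (hq : 0 ≤ q)
    (ht : Real.exp t ∈ dilationSet ξ₁ ξ₂ (j + 1) q) : Lmin ξ₁ ξ₂ (j + 1) q ≤ t := by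
  rw [Lmin, Real.log_le_iff_le_exp ((Real.exp_pos _).trans_le (exp_le_lambdaMin hq ⟨_, ht⟩))]
  exact csInf_le (bddBelow_dilationSet ξ₁ ξ₂ _ q) ht

lemma exp_mem_dilationSet_three {ξ₁ ξ₂ q : ℝ} (hq : 0 ≤ q) :
    Real.exp q ∈ dilationSet ξ₁ ξ₂ 3 q := by
  refine ⟨Real.exp_pos _, ![![1, ξ₁ - round ξ₁, ξ₂ - round ξ₂], ![0, 1, 0], ![0, 0, 1]], ?_, ?_⟩
  · refine (Matrix.linearIndependent_rows_iff_isUnit (A := Matrix.of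
      ![![1, ξ₁ - round ξ₁, ξ₂ - round ξ₂], ![0, 1, 0], ![0, 0, 1]])).2 ?_
    rw [Matrix.isUnit_iff_isUnit_det, Matrix.det_fin_three]
    simp
  · have e1 : Real.exp q * Real.exp (-q) = 1 := by rw [← Real.exp_add]; simp
    have e2 : 1 ≤ Real.exp q * Real.exp (2 * q) := by
      rw [← Real.exp_add]; exact Real.one_le_exp (by linarith)
    have r1 := abs_sub_round ξ₁
    have r2 := abs_sub_round ξ₂
    intro i
    rw [mem_smul_Box (Real.exp_pos _), e1]
    fin_cases i
    · refine ⟨⟨1, round ξ₁, round ξ₂, by simp⟩, ?_⟩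
      simp only [Fin.zero_eta, Matrix.cons_val_zero, Matrix.cons_val_one, Matrix.cons_val]
      refine ⟨by simpa using e2, by linarith, by linarith⟩
    · exact ⟨⟨0, -1, 0, by simp⟩, by simp; positivity⟩
    · exact ⟨⟨0, 0, -1, by simp⟩, by simp; positivity⟩

/-- Three linearly independent lattice points span a parallelepiped of volume at least one. -/
lemma one_le_six_mul_of_linearIndependent {ξ₁ ξ₂ q l₁ l₂ l₃ : ℝ} {a b c : Fin 3 → ℝ}
    (h : LinearIndependent ℝ ![a, b, c]) (hl₁ : 0 < l₁) (hl₂ : 0 < l₂) (hl₃ : 0 < l₃)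
    (ha : a ∈ LatticeSet ξ₁ ξ₂) (hb : b ∈ LatticeSet ξ₁ ξ₂) (hc : c ∈ LatticeSet ξ₁ ξ₂)
    (ha' : a ∈ l₁ • Box q) (hb' : b ∈ l₂ • Box q) (hc' : c ∈ l₃ • Box q) :
    1 ≤ 6 * l₁ * l₂ * l₃ := by
  have hdet : (Matrix.of ![a, b, c]).det ≠ 0 := by
    have hu := Matrix.linearIndependent_rows_iff_isUnit (A := Matrix.of ![a, b, c]) |>.1 h
    exact ((Matrix.isUnit_iff_isUnit_det _).1 hu).ne_zero
  rw [Matrix.det_fin_three] at hdet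
  simp only [Matrix.of_apply, Matrix.cons_val_zero, Matrix.cons_val_one, Matrix.cons_val] at hdet
  rw [mem_smul_Box (by assumption)] at ha' hb' hc'
  set E := Real.exp (-q)
  have hE : Real.exp (2 * q) * (E * E) = 1 := by
    simp only [E, ← Real.exp_add]; ring_nf; simp
  set F := Real.exp (2 * q)
  have hE0 : 0 < E := Real.exp_pos _
  have hF0 : 0 < F := Real.exp_pos _
  have bound : ∀ {x y z A B C : ℝ}, |x| ≤ A → |y| ≤ B → |z| ≤ C → |x * y * z| ≤ A * B * C := by
    intro x y z A B C hx hy hz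
    have hA := (abs_nonneg x).trans hx
    have hB := (abs_nonneg y).trans hy
    rw [abs_mul, abs_mul]
    gcongr
  obtain ⟨a0, a1, a2⟩ := ha'
  obtain ⟨b0, b1, b2⟩ := hb'
  obtain ⟨c0, c1, c2⟩ := hc'
  have t1 := bound a0 b1 c2
  have t2 := bound a0 b2 c1
  have t3 := bound a1 b0 c2
  have t4 := bound a1 b2 c0
  have t5 := bound a2 b0 c1
  have t6 := bound a2 b1 c0
  have s1 : l₁ * F * (l₂ * E) * (l₃ * E) = l₁ * l₂ * l₃ := by linear_combination l₁ * l₂ * l₃ * hE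
  have s2 : l₁ * E * (l₂ * F) * (l₃ * E) = l₁ * l₂ * l₃ := by linear_combination l₁ * l₂ * l₃ * hE
  have s3 : l₁ * E * (l₂ * E) * (l₃ * F) = l₁ * l₂ * l₃ := by linear_combination l₁ * l₂ * l₃ * hE
  rw [s1] at t1 t2
  rw [s2] at t3 t5
  rw [s3] at t4 t6
  obtain ⟨x, y, z, hx, hy, hz⟩ := ha
  obtain ⟨x', y', z', hx', hy', hz'⟩ := hb
  obtain ⟨x'', y'', z'', hx'', hy'', hz''⟩ := hc
  have hint : a 0 * b 1 * c 2 - a 0 * b 2 * c 1 - a 1 * b 0 * c 2 + a 1 * b 2 * c 0 +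
      a 2 * b 0 * c 1 - a 2 * b 1 * c 0 =
      ((x * y' * z'' - x * z' * y'' - y * x' * z'' + y * z' * x'' + z * x' * y''
        - z * y' * x'' : ℤ) : ℝ) := by
    push_cast
    rw [hx, hy, hz, hx', hy', hz', hx'', hy'', hz'']
    ring
  have h1 : (1 : ℝ) ≤ |a 0 * b 1 * c 2 - a 0 * b 2 * c 1 - a 1 * b 0 * c 2 + a 1 * b 2 * c 0 +
      a 2 * b 0 * c 1 - a 2 * b 1 * c 0| := by
    rw [hint] at hdet ⊢
    exact_mod_cast Int.one_le_abs (by exact_mod_cast hdet)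
  rw [abs_le] at t1 t2 t3 t4 t5 t6
  rcases le_abs.1 h1 with h1 | h1 <;> linarith

/-- Among more than `k` independent vectors, one is independent of `k` given ones. -/
lemma exists_linearIndependent_cons {V : Type*} [AddCommGroup V] [Module ℝ V] {k m : ℕ}
    (hkm : k < m) {x : Fin k → V} {u : Fin m → V} (hx : LinearIndependent ℝ x)
    (hu : LinearIndependent ℝ u) :
    ∃ i, LinearIndependent ℝ (Fin.cons (u i) x : Fin (k + 1) → V) := by
  by_contra! hcon
  have hmem : ∀ i, u i ∈ Submodule.span ℝ (Set.range x) := by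
    intro i
    by_contra hi
    exact hcon i (linearIndependent_finCons.2 ⟨hx, hi⟩)
  have hle : Submodule.span ℝ (Set.range u) ≤ Submodule.span ℝ (Set.range x) :=
    Submodule.span_le.2 (Set.range_subset_iff.2 hmem)
  have := FiniteDimensional.span_of_finite ℝ (Set.finite_range x)
  have h := Submodule.finrank_mono hle
  rw [finrank_span_eq_card hu, finrank_span_eq_card hx, Fintype.card_fin, Fintype.card_fin] at h
  omega

lemma one_le_six_mul_of_mem_dilationSet {ξ₁ ξ₂ q l₁ l₂ l₃ : ℝ}
    (h₁ : l₁ ∈ dilationSet ξ₁ ξ₂ 1 q) (h₂ : l₂ ∈ dilationSet ξ₁ ξ₂ 2 q)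
    (h₃ : l₃ ∈ dilationSet ξ₁ ξ₂ 3 q) : 1 ≤ 6 * l₁ * l₂ * l₃ := by
  obtain ⟨hl₁, v, hv, hvm⟩ := h₁
  obtain ⟨hl₂, w, hw, hwm⟩ := h₂
  obtain ⟨hl₃, u, hu, hum⟩ := h₃
  obtain ⟨i, hi⟩ := exists_linearIndependent_cons (by norm_num) hv hw
  obtain ⟨k, hk⟩ := exists_linearIndependent_cons (by norm_num) hi hu
  have heq : (Fin.cons (u k) (Fin.cons (w i) v) : Fin 3 → (Fin 3 → ℝ)) = ![u k, w i, v 0] := by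
    ext a b
    fin_cases a <;> rfl
  have h := one_le_six_mul_of_linearIndependent (heq ▸ hk) hl₃ hl₂ hl₁ (hum k).1 (hwm i).1
    (hvm 0).1 (hum k).2 (hwm i).2 (hvm 0).2
  linarith

lemma one_le_mul_csInf {S : Set ℝ} (hne : S.Nonempty) {c : ℝ} (hc : 0 < c)
    (h : ∀ l ∈ S, 1 ≤ c * l) : 1 ≤ c * sInf S := by
  rw [← div_le_iff₀' hc]
  exact le_csInf hne fun l hl => (div_le_iff₀' hc).2 (h l hl)

lemma nonempty_dilationSet_three {ξ₁ ξ₂ q : ℝ} (hq : 0 ≤ q) :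
    (dilationSet ξ₁ ξ₂ 3 q).Nonempty := ⟨_, exp_mem_dilationSet_three hq⟩

lemma nonempty_dilationSet_two {ξ₁ ξ₂ q : ℝ} (hq : 0 ≤ q) :
    (dilationSet ξ₁ ξ₂ 2 q).Nonempty :=
  (nonempty_dilationSet_three hq).mono (dilationSet_succ_subset ξ₁ ξ₂ 2 q)

lemma nonempty_dilationSet_one {ξ₁ ξ₂ q : ℝ} (hq : 0 ≤ q) :
    (dilationSet ξ₁ ξ₂ 1 q).Nonempty :=
  (nonempty_dilationSet_two hq).mono (dilationSet_succ_subset ξ₁ ξ₂ 1 q)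

/-- The lower bound in Minkowski's second theorem. -/
lemma neg_log_six_le_sum_Lmin {ξ₁ ξ₂ q : ℝ} (hq : 0 ≤ q) :
    -Real.log 6 ≤ Lmin ξ₁ ξ₂ 1 q + Lmin ξ₁ ξ₂ 2 q + Lmin ξ₁ ξ₂ 3 q := by
  have p1 := (Real.exp_pos _).trans_le (exp_le_lambdaMin (ξ₁ := ξ₁) (ξ₂ := ξ₂) hq
    (nonempty_dilationSet_one hq))
  have p2 := (Real.exp_pos _).trans_le (exp_le_lambdaMin (ξ₁ := ξ₁) (ξ₂ := ξ₂) hq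
    (nonempty_dilationSet_two hq))
  have p3 := (Real.exp_pos _).trans_le (exp_le_lambdaMin (ξ₁ := ξ₁) (ξ₂ := ξ₂) hq
    (nonempty_dilationSet_three hq))
  have h : 1 ≤ 6 * lambdaMin ξ₁ ξ₂ 1 q * lambdaMin ξ₁ ξ₂ 2 q * lambdaMin ξ₁ ξ₂ 3 q := by
    refine one_le_mul_csInf (nonempty_dilationSet_three hq) (by positivity) fun l₃ h₃ => ?_
    have := h₃.1
    rw [mul_right_comm]
    refine one_le_mul_csInf (nonempty_dilationSet_two hq) (by positivity) fun l₂ h₂ => ?_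
    have := h₂.1
    rw [show ∀ a b c d : ℝ, a * b * c * d = a * c * d * b by intros; ring]
    refine one_le_mul_csInf (nonempty_dilationSet_one hq) (by positivity) fun l₁ h₁ => ?_
    linarith [one_le_six_mul_of_mem_dilationSet h₁ h₂ h₃]
  have := Real.log_nonneg h
  rw [Real.log_mul (by positivity) p3.ne', Real.log_mul (by positivity) p2.ne',
    Real.log_mul (by positivity) p1.ne'] at this
  simp only [Lmin]
  linarith

lemma Lmin_three_le {ξ₁ ξ₂ q : ℝ} (hq : 0 ≤ q) : Lmin ξ₁ ξ₂ 3 q ≤ q :=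
  Lmin_le_of_exp_mem hq (exp_mem_dilationSet_three hq)

lemma Lmin_le_succ {ξ₁ ξ₂ q : ℝ} {j : ℕ} (hq : 0 ≤ q)
    (hne : (dilationSet ξ₁ ξ₂ (j + 1 + 1) q).Nonempty) :
    Lmin ξ₁ ξ₂ (j + 1) q ≤ Lmin ξ₁ ξ₂ (j + 1 + 1) q :=
  Real.log_le_log
    ((Real.exp_pos _).trans_le
      (exp_le_lambdaMin hq (hne.mono (dilationSet_succ_subset ξ₁ ξ₂ _ q))))
    (csInf_le_csInf (bddBelow_dilationSet ξ₁ ξ₂ _ q) hne (dilationSet_succ_subset ξ₁ ξ₂ _ q))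

lemma neg_two_mul_le_Lmin_one {ξ₁ ξ₂ q : ℝ} (hq : 0 ≤ q) : -2 * q ≤ Lmin ξ₁ ξ₂ 1 q := by
  have h := exp_le_lambdaMin (ξ₁ := ξ₁) (ξ₂ := ξ₂) hq (nonempty_dilationSet_one hq)
  rwa [Lmin, Real.le_log_iff_exp_le ((Real.exp_pos _).trans_le h)]

/-- Truncating a lacunary decimal expansion after its `K`-th nonzero digit. -/
lemma exists_int_approx {a : ℕ → ℕ} (ha : StrictMono a) {K N : ℕ} (hN : ∀ k < K, a k ≤ N) :
    ∃ y : ℤ, (10 : ℝ) ^ N / 10 ^ a K ≤ (∑' k, (10 : ℝ) ^ (-(a k : ℤ))) * 10 ^ N - y ∧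
      (∑' k, (10 : ℝ) ^ (-(a k : ℤ))) * 10 ^ N - y ≤ 2 * (10 ^ N / 10 ^ a K) := by
  have hterm : ∀ k, (10 : ℝ) ^ (-(a k : ℤ)) = (1 / 10) ^ a k := fun k => by
    rw [zpow_neg, zpow_natCast, one_div, inv_pow]
  simp only [hterm]
  have hgeom : Summable fun k : ℕ => (1 / 10 : ℝ) ^ k :=
    summable_geometric_of_lt_one (by norm_num) (by norm_num)
  have hsum : Summable fun k => (1 / 10 : ℝ) ^ a k := hgeom.comp_injective ha.injective
  have htail : Summable fun k => (1 / 10 : ℝ) ^ a (k + K) :=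
    hsum.comp_injective (add_left_injective K)
  refine ⟨∑ k ∈ Finset.range K, 10 ^ (N - a k), ?_⟩
  have hint : ((∑ k ∈ Finset.range K, 10 ^ (N - a k) : ℤ) : ℝ) =
      (∑ k ∈ Finset.range K, (1 / 10 : ℝ) ^ a k) * 10 ^ N := by
    push_cast
    rw [Finset.sum_mul]
    refine Finset.sum_congr rfl fun k hk => ?_
    rw [← Nat.sub_add_cancel (hN k (Finset.mem_range.1 hk)), pow_add, Nat.add_sub_cancel,
      one_div, inv_pow]
    field_simp
  have hlow : (1 / 10 : ℝ) ^ a K ≤ ∑' k, (1 / 10 : ℝ) ^ a (k + K) := by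
    simpa using htail.le_tsum 0 fun _ _ => by positivity
  have hup : ∑' k, (1 / 10 : ℝ) ^ a (k + K) ≤ 2 * (1 / 10) ^ a K := by
    have hle : ∀ k, (1 / 10 : ℝ) ^ a (k + K) ≤ (1 / 10) ^ a K * (1 / 10) ^ k := fun k => by
      rw [← pow_add]
      refine pow_le_pow_of_le_one (by norm_num) (by norm_num) ?_
      rw [Nat.add_comm (a K)]
      exact ha.add_le_nat k K
    refine (htail.tsum_le_tsum hle (hgeom.mul_left _)).trans ?_
    rw [tsum_mul_left, tsum_geometric_of_lt_one (by norm_num) (by norm_num), mul_comm]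
    gcongr
    norm_num
  have hp : (0 : ℝ) < 10 ^ N := by positivity
  have hdiv : (10 : ℝ) ^ N / 10 ^ a K = (1 / 10) ^ a K * 10 ^ N := by
    rw [one_div, inv_pow]; field_simp
  rw [hint, ← hsum.sum_add_tsum_nat_add K, hdiv, add_mul, add_sub_cancel_left, ← mul_assoc]
  exact ⟨by gcongr, by gcongr⟩

lemma strictMono_factorial_comp {f : ℕ → ℕ} (hf : StrictMono f) (h0 : ∀ k, 0 < f k) :
    StrictMono fun k => (f k).factorial :=
  fun _ _ hij => Nat.factorial_lt_of_lt (h0 _) (hf hij)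

lemma ten_pow_div_le {M M' : ℕ} (N : ℕ) (h : M ≤ M') :
    (10 : ℝ) ^ N / 10 ^ M' ≤ 10 ^ N / 10 ^ M := by
  gcongr; norm_num

/-- A lattice point whose first coordinate is `10 ^ n!`. -/
lemma exists_mem_LatticeSet {ξ₁ ξ₂ : ℝ}
    (hξ₁ : ξ₁ = ∑' k : ℕ, (10 : ℝ) ^ (-((2 * (k + 1) - 1).factorial : ℤ)))
    (hξ₂ : ξ₂ = ∑' k : ℕ, (10 : ℝ) ^ (-((2 * (k + 1)).factorial : ℤ))) (n : ℕ) :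
    ∃ v ∈ LatticeSet ξ₁ ξ₂, v 0 = 10 ^ n.factorial ∧
      |v 1| ≤ 2 * (10 ^ n.factorial / 10 ^ (n + 1).factorial) ∧
      |v 2| ≤ 2 * (10 ^ n.factorial / 10 ^ (n + 1).factorial) ∧
      ((10 : ℝ) ^ n.factorial / 10 ^ (n + 1).factorial ≤ |v 1| ∨
        (10 : ℝ) ^ n.factorial / 10 ^ (n + 1).factorial ≤ |v 2|) := by
  have ha₁ : StrictMono fun k => (2 * (k + 1) - 1).factorial :=
    strictMono_factorial_comp (fun i j h => by omega) fun k => by omega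
  have ha₂ : StrictMono fun k => (2 * (k + 1)).factorial :=
    strictMono_factorial_comp (fun i j h => by omega) fun k => by omega
  obtain ⟨K₁, K₂, h₁, h₂, h₃, h₄, h₅⟩ : ∃ K₁ K₂ : ℕ, (∀ k < K₁, 2 * (k + 1) - 1 ≤ n) ∧
      (∀ k < K₂, 2 * (k + 1) ≤ n) ∧ n + 1 ≤ 2 * (K₁ + 1) - 1 ∧ n + 1 ≤ 2 * (K₂ + 1) ∧
      (2 * (K₁ + 1) - 1 = n + 1 ∨ 2 * (K₂ + 1) = n + 1) := by
    obtain ⟨m, rfl | rfl⟩ := n.even_or_odd'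
    · exact ⟨m, m, by omega, by omega, by omega, by omega, by omega⟩
    · exact ⟨m + 1, m, by omega, by omega, by omega, by omega, by omega⟩
  obtain ⟨y₁, l₁, u₁⟩ := exists_int_approx ha₁ fun k hk => Nat.factorial_le (h₁ k hk)
  obtain ⟨y₂, l₂, u₂⟩ := exists_int_approx ha₂ fun k hk => Nat.factorial_le (h₂ k hk)
  rw [← hξ₁] at l₁ u₁
  rw [← hξ₂] at l₂ u₂
  have d₁ := ten_pow_div_le n.factorial (Nat.factorial_le h₃)
  have d₂ := ten_pow_div_le n.factorial (Nat.factorial_le h₄)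
  have e₁ : |ξ₁ * 10 ^ n.factorial - y₁| = ξ₁ * 10 ^ n.factorial - y₁ :=
    abs_of_nonneg (le_trans (by positivity) l₁)
  have e₂ : |ξ₂ * 10 ^ n.factorial - y₂| = ξ₂ * 10 ^ n.factorial - y₂ :=
    abs_of_nonneg (le_trans (by positivity) l₂)
  refine ⟨![10 ^ n.factorial, ξ₁ * 10 ^ n.factorial - y₁, ξ₂ * 10 ^ n.factorial - y₂],
    ⟨10 ^ n.factorial, y₁, y₂, by simp⟩, rfl, ?_⟩
  simp only [Matrix.cons_val_one, Matrix.cons_val_zero, Matrix.cons_val]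
  rw [e₁, e₂]
  refine ⟨by linarith, by linarith, ?_⟩
  rcases h₅ with h | h
  · rw [h] at l₁; exact .inl l₁
  · rw [h] at l₂; exact .inr l₂

lemma linearIndependent_pair_of_approx {v w : Fin 3 → ℝ} {r A : ℝ} (hr : 0 < r) (hA : 0 < A)
    (hv : v 0 = r * A) (hw : w 0 = A) (hrv : r ≤ |v 1| ∨ r ≤ |v 2|)
    (h1 : |w 1| < 1) (h2 : |w 2| < 1) : LinearIndependent ℝ ![v, w] := by
  rw [LinearIndependent.pair_iff]
  intro s t hst
  have hc : ∀ i, s * v i + t * w i = 0 := fun i => by simpa using congrFun hst i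
  have h0 := hc 0
  have ht : t = -(s * r) := by
    rw [hv, hw] at h0
    have : (s * r + t) * A = 0 := by linarith
    rcases mul_eq_zero.1 this with h | h
    · linarith
    · exact absurd h hA.ne'
  have hs : s = 0 := by
    by_contra hs
    have hvw : ∀ i, |v i| = r * |w i| := fun i => by
      have : s * (v i - r * w i) = 0 := by rw [← hc i, ht]; ring
      rcases mul_eq_zero.1 this with h | h
      · exact absurd h hs
      · rw [sub_eq_zero.1 h, abs_mul, abs_of_pos hr]
    rcases hrv with h | h <;> rw [hvw] at h <;> nlinarith
  exact ⟨hs, by rw [ht, hs]; simp⟩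

/-- `logHeight n = log (10 ^ n!)`. -/
noncomputable def logHeight (n : ℕ) : ℝ := n.factorial * Real.log 10

lemma exp_logHeight (n : ℕ) : Real.exp (logHeight n) = 10 ^ n.factorial := by
  rw [logHeight, mul_comm, Real.exp_mul, Real.exp_log (by norm_num), Real.rpow_natCast]

/-- The logarithm of a dilation factor of `Box q` reaching the lattice point of height `10 ^ n!`. -/
noncomputable def trajectory (n : ℕ) (q : ℝ) : ℝ :=
  max (logHeight n - 2 * q) (q + logHeight n - logHeight (n + 1)) + Real.log 2

lemma logHeight_pos (n : ℕ) : 0 < logHeight n :=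
  mul_pos (by positivity) (Real.log_pos (by norm_num))

lemma logHeight_succ (n : ℕ) : logHeight (n + 1) = (n + 1) * logHeight n := by
  rw [logHeight, logHeight, Nat.factorial_succ]
  push_cast
  ring

lemma tendsto_logHeight : Tendsto logHeight atTop atTop :=
  (tendsto_natCast_atTop_atTop.comp (tendsto_atTop_mono Nat.self_le_factorial tendsto_id)
    ).atTop_mul_const (Real.log_pos (by norm_num))

lemma eventually_logHeight_add_le (c : ℝ) {ε : ℝ} (hε : 0 < ε) :
    ∀ᶠ n in atTop, logHeight n + c ≤ ε * logHeight (n + 1) := by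
  filter_upwards [tendsto_logHeight.eventually_ge_atTop c,
    tendsto_natCast_atTop_atTop.eventually_ge_atTop (2 / ε)] with n hc hn
  rw [div_le_iff₀ hε] at hn
  rw [logHeight_succ]
  nlinarith [logHeight_pos n, mul_pos hε (logHeight_pos n)]

lemma trajectory_of_ge {n : ℕ} {q : ℝ} (h : logHeight (n + 1) ≤ 3 * q) :
    trajectory n q = q + logHeight n - logHeight (n + 1) + Real.log 2 := by
  rw [trajectory, max_eq_right (by linarith)]

lemma trajectory_of_le {n : ℕ} {q : ℝ} (h : 3 * q ≤ logHeight (n + 1)) :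
    trajectory n q = logHeight n - 2 * q + Real.log 2 := by
  rw [trajectory, max_eq_left (by linarith)]

lemma exists_trajectory_points {ξ₁ ξ₂ : ℝ}
    (hξ₁ : ξ₁ = ∑' k : ℕ, (10 : ℝ) ^ (-((2 * (k + 1) - 1).factorial : ℤ)))
    (hξ₂ : ξ₂ = ∑' k : ℕ, (10 : ℝ) ^ (-((2 * (k + 1)).factorial : ℤ))) :
    ∃ v : ℕ → Fin 3 → ℝ, (∀ n, v n ∈ LatticeSet ξ₁ ξ₂) ∧
      (∀ n q, v n ∈ Real.exp (trajectory n q) • Box q) ∧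
      ∀ n, 1 ≤ n → LinearIndependent ℝ ![v n, v (n + 1)] := by
  choose v hv h0 h1 h2 h3 using exists_mem_LatticeSet hξ₁ hξ₂
  refine ⟨v, hv, fun n q => ?_, fun n hn => ?_⟩
  · rw [mem_smul_Box (Real.exp_pos _), h0, ← Real.exp_add, ← Real.exp_add]
    have hdiv : 2 * ((10 : ℝ) ^ n.factorial / 10 ^ (n + 1).factorial) =
        Real.exp (Real.log 2 + (logHeight n - logHeight (n + 1))) := by
      rw [Real.exp_add, Real.exp_log (by norm_num), Real.exp_sub, exp_logHeight, exp_logHeight]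
    have m1 := le_max_left (logHeight n - 2 * q) (q + logHeight n - logHeight (n + 1))
    have m2 := le_max_right (logHeight n - 2 * q) (q + logHeight n - logHeight (n + 1))
    have hlog : 0 ≤ Real.log 2 := Real.log_nonneg (by norm_num)
    have herr : 2 * ((10 : ℝ) ^ n.factorial / 10 ^ (n + 1).factorial) ≤
        Real.exp (trajectory n q + -q) := by
      rw [hdiv, Real.exp_le_exp, trajectory]
      linarith
    refine ⟨?_, (h1 n).trans herr, (h2 n).trans herr⟩
    rw [abs_of_pos (by positivity), ← exp_logHeight, Real.exp_le_exp, trajectory]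
    linarith
  · have hsmall : 2 * ((10 : ℝ) ^ (n + 1).factorial / 10 ^ (n + 1 + 1).factorial) < 1 := by
      have hlt : (n + 1).factorial + 1 ≤ (n + 1 + 1).factorial :=
        Nat.factorial_lt_of_lt (by omega) (by omega)
      have := ten_pow_div_le (n + 1).factorial hlt
      rw [pow_succ, div_mul_eq_div_div, div_self (by positivity)] at this
      linarith
    refine linearIndependent_pair_of_approx
      (r := 10 ^ n.factorial / 10 ^ (n + 1).factorial) (A := 10 ^ (n + 1).factorial)
      (by positivity) (by positivity) ?_ (h0 _) (h3 n) ((h1 _).trans_lt hsmall)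
      ((h2 _).trans_lt hsmall)
    rw [h0, div_mul_cancel₀ _ (by positivity)]

lemma Lmin_two_le_max_trajectory {ξ₁ ξ₂ : ℝ}
    (hξ₁ : ξ₁ = ∑' k : ℕ, (10 : ℝ) ^ (-((2 * (k + 1) - 1).factorial : ℤ)))
    (hξ₂ : ξ₂ = ∑' k : ℕ, (10 : ℝ) ^ (-((2 * (k + 1)).factorial : ℤ)))
    {q : ℝ} {n : ℕ} (hq : 0 ≤ q) (hn : 1 ≤ n) :
    Lmin ξ₁ ξ₂ 2 q ≤ max (trajectory n q) (trajectory (n + 1) q) := by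
  obtain ⟨v, hv, hK, hli⟩ := exists_trajectory_points hξ₁ hξ₂
  refine Lmin_le_of_exp_mem hq ⟨Real.exp_pos _, _, hli n hn, fun i => ?_⟩
  fin_cases i
  · exact ⟨hv _, smul_Box_mono (Real.exp_pos _) (Real.exp_le_exp.2 (le_max_left _ _)) (hK n q)⟩
  · exact ⟨hv _, smul_Box_mono (Real.exp_pos _) (Real.exp_le_exp.2 (le_max_right _ _))
      (hK (n + 1) q)⟩

lemma Lmin_one_le_trajectory {ξ₁ ξ₂ : ℝ}
    (hξ₁ : ξ₁ = ∑' k : ℕ, (10 : ℝ) ^ (-((2 * (k + 1) - 1).factorial : ℤ)))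
    (hξ₂ : ξ₂ = ∑' k : ℕ, (10 : ℝ) ^ (-((2 * (k + 1)).factorial : ℤ)))
    {q : ℝ} {n : ℕ} (hq : 0 ≤ q) (hn : 1 ≤ n) :
    Lmin ξ₁ ξ₂ 1 q ≤ trajectory n q := by
  obtain ⟨v, hv, hK, hli⟩ := exists_trajectory_points hξ₁ hξ₂
  refine Lmin_le_of_exp_mem hq ⟨Real.exp_pos _, ![v n], ?_, fun i => ?_⟩
  · exact (linearIndependent_unique_iff (ι := Fin 1)).2 ((hli n hn).ne_zero 0)
  · fin_cases i
    exact ⟨hv n, hK n q⟩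

lemma Lmin_one_add_Lmin_two_le {ξ₁ ξ₂ : ℝ}
    (hξ₁ : ξ₁ = ∑' k : ℕ, (10 : ℝ) ^ (-((2 * (k + 1) - 1).factorial : ℤ)))
    (hξ₂ : ξ₂ = ∑' k : ℕ, (10 : ℝ) ^ (-((2 * (k + 1)).factorial : ℤ)))
    {q : ℝ} {n : ℕ} (hq : 0 ≤ q) (hn : 1 ≤ n) :
    Lmin ξ₁ ξ₂ 1 q + Lmin ξ₁ ξ₂ 2 q ≤ trajectory n q + trajectory (n + 1) q := by
  have h1 := Lmin_one_le_trajectory hξ₁ hξ₂ hq hn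
  have h2 := Lmin_one_le_trajectory hξ₁ hξ₂ hq (Nat.le_succ_of_le hn)
  rcases le_max_iff.1 (Lmin_two_le_max_trajectory hξ₁ hξ₂ hq hn) with h | h <;> linarith

lemma eventually_Lmin_one_add_Lmin_two_le {ξ₁ ξ₂ : ℝ}
    (hξ₁ : ξ₁ = ∑' k : ℕ, (10 : ℝ) ^ (-((2 * (k + 1) - 1).factorial : ℤ)))
    (hξ₂ : ξ₂ = ∑' k : ℕ, (10 : ℝ) ^ (-((2 * (k + 1)).factorial : ℤ)))
    {ε : ℝ} (hε : 0 < ε) :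
    ∀ᶠ q in atTop, Lmin ξ₁ ξ₂ 1 q + Lmin ξ₁ ξ₂ 2 q ≤ (-1 + ε) * q := by
  obtain ⟨N, hN⟩ := eventually_atTop.1
    (eventually_logHeight_add_le (2 * Real.log 2) (ε := ε / 3) (by positivity))
  have hmono : StrictMono fun k => logHeight (N + 1 + 1 + k) / 3 := fun i j hij => by
    have := Nat.factorial_lt_of_lt (m := N + 1 + 1 + j) (show 0 < N + 1 + 1 + i by omega)
      (by omega)
    have hlog : 0 < Real.log 10 := Real.log_pos (by norm_num)
    simp only [logHeight]
    gcongr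
  have htend : Tendsto (fun k => logHeight (N + 1 + 1 + k) / 3) atTop atTop := by
    simp only [add_comm (N + 1 + 1)]
    exact (tendsto_logHeight.comp (tendsto_add_atTop_nat (N + 1 + 1))).atTop_div_const
      (by norm_num)
  filter_upwards [eventually_gt_atTop (logHeight (N + 1 + 1 + 0) / 3), eventually_ge_atTop 0]
    with q hq hq0
  obtain ⟨k, hk₁, hk₂⟩ := hmono.exists_between_of_tendsto_atTop htend hq
  have h := Lmin_one_add_Lmin_two_le hξ₁ hξ₂ hq0 (n := N + 1 + k) (by omega)
  have hb := hN (N + 1 + k) (by omega)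
  rw [show N + 1 + 1 + k = N + 1 + k + 1 by ring] at hk₁
  rw [show N + 1 + 1 + (k + 1) = N + 1 + k + 1 + 1 by ring] at hk₂
  rw [trajectory_of_ge (by linarith), trajectory_of_le (by linarith)] at h
  nlinarith

lemma frequently_Lmin_one_le {ξ₁ ξ₂ : ℝ}
    (hξ₁ : ξ₁ = ∑' k : ℕ, (10 : ℝ) ^ (-((2 * (k + 1) - 1).factorial : ℤ)))
    (hξ₂ : ξ₂ = ∑' k : ℕ, (10 : ℝ) ^ (-((2 * (k + 1)).factorial : ℤ)))
    {ε : ℝ} (hε : 0 < ε) :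
    ∃ᶠ q in atTop, Lmin ξ₁ ξ₂ 1 q ≤ (-2 + ε) * q := by
  have htend : Tendsto (fun n => logHeight (n + 1) / 3) atTop atTop :=
    (tendsto_logHeight.comp (tendsto_add_atTop_nat 1)).atTop_div_const (by norm_num)
  refine htend.frequently (Eventually.frequently ?_)
  filter_upwards [eventually_logHeight_add_le (Real.log 2) (ε := ε / 3) (by positivity),
    eventually_ge_atTop 1, htend.eventually_ge_atTop 0] with n hn h1 h0
  have h := Lmin_one_le_trajectory hξ₁ hξ₂ h0 h1
  rw [trajectory_of_le (by linarith)] at h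
  linarith

lemma frequently_Lmin_two_le {ξ₁ ξ₂ : ℝ}
    (hξ₁ : ξ₁ = ∑' k : ℕ, (10 : ℝ) ^ (-((2 * (k + 1) - 1).factorial : ℤ)))
    (hξ₂ : ξ₂ = ∑' k : ℕ, (10 : ℝ) ^ (-((2 * (k + 1)).factorial : ℤ)))
    {ε : ℝ} (hε : 0 < ε) :
    ∃ᶠ q in atTop, Lmin ξ₁ ξ₂ 2 q ≤ (-(1 / 2) + ε) * q := by
  have htend : Tendsto (fun n => logHeight (n + 1) * (2 / 3)) atTop atTop :=
    (tendsto_logHeight.comp (tendsto_add_atTop_nat 1)).atTop_mul_const (by norm_num)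
  refine htend.frequently (Eventually.frequently ?_)
  filter_upwards [eventually_logHeight_add_le (Real.log 2) (ε := ε * (2 / 3)) (by positivity),
    eventually_ge_atTop 1, htend.eventually_ge_atTop 0] with n hn h1 h0
  have h := Lmin_two_le_max_trajectory hξ₁ hξ₂ h0 h1
  have hpos := logHeight_pos n
  have hsucc := logHeight_succ (n + 1)
  have hn1 : (1 : ℝ) ≤ n := by exact_mod_cast h1
  push_cast at hsucc
  rw [trajectory_of_ge (by linarith), trajectory_of_le (by nlinarith)] at h
  refine h.trans (max_le ?_ ?_) <;> linarith

lemma liminf_div_eq {f : ℝ → ℝ} {a : ℝ} (hlow : ∀ᶠ q in atTop, -2 * q ≤ f q)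
    (h : ∀ ε > 0, ∀ᶠ q in atTop, (a - ε) * q ≤ f q)
    (h' : ∀ ε > 0, ∃ᶠ q in atTop, f q ≤ (a + ε) * q) :
    liminf (fun q => f q / q) atTop = a := by
  have hbdd : IsBoundedUnder (· ≥ ·) atTop fun q => f q / q := by
    refine ⟨-2, eventually_map.2 ?_⟩
    filter_upwards [hlow, eventually_gt_atTop 0] with q h1 h2
    exact (le_div_iff₀ h2).2 h1
  have hfreq : ∀ ε > 0, ∃ᶠ q in atTop, f q / q ≤ a + ε := fun ε hε =>
    ((h' ε hε).and_eventually (eventually_gt_atTop 0)).mono fun q hq =>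
      (div_le_iff₀ hq.2).2 hq.1
  refine le_antisymm (le_of_forall_pos_le_add fun ε hε =>
    liminf_le_of_frequently_le (hfreq ε hε) hbdd) (le_of_forall_pos_sub_le fun ε hε =>
    le_liminf_of_le (IsCoboundedUnder.of_frequently_le (hfreq 1 one_pos)) ?_)
  filter_upwards [h ε hε, eventually_gt_atTop 0] with q h1 h2
  exact (le_div_iff₀ h2).2 h1

lemma limsup_div_eq {f : ℝ → ℝ} {a : ℝ} (hup : ∀ᶠ q in atTop, f q ≤ q)
    (h : ∀ ε > 0, ∀ᶠ q in atTop, f q ≤ (a + ε) * q)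
    (h' : ∀ ε > 0, ∃ᶠ q in atTop, (a - ε) * q ≤ f q) :
    limsup (fun q => f q / q) atTop = a := by
  have hbdd : IsBoundedUnder (· ≤ ·) atTop fun q => f q / q := by
    refine ⟨1, eventually_map.2 ?_⟩
    filter_upwards [hup, eventually_gt_atTop 0] with q h1 h2
    exact (div_le_one h2).2 h1
  have hfreq : ∀ ε > 0, ∃ᶠ q in atTop, a - ε ≤ f q / q := fun ε hε =>
    ((h' ε hε).and_eventually (eventually_gt_atTop 0)).mono fun q hq =>
      (le_div_iff₀ hq.2).2 hq.1
  refine le_antisymm (le_of_forall_pos_le_add fun ε hε =>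
    limsup_le_of_le (IsCoboundedUnder.of_frequently_ge (hfreq 1 one_pos)) ?_)
    (le_of_forall_pos_sub_le fun ε hε => le_limsup_of_frequently_le (hfreq ε hε) hbdd)
  filter_upwards [h ε hε, eventually_gt_atTop 0] with q h1 h2
  exact (div_le_iff₀ h2).2 h1

/-- For `ξ₁ = Σ_{k≥1} 10^{-(2k-1)!}` and `ξ₂ = Σ_{k≥1} 10^{-(2k)!}` one has
`φ̲₁ = -2`, `φ̲₂ = -1/2`, `φ̲₃ = 1`, `φ̄₁ = -1/2`, `φ̄₂ = 1`, `φ̄₃ = 1`. -/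
theorem phi_of_explicit_pair
    (ξ₁ ξ₂ : ℝ)
    (hξ₁ : ξ₁ = ∑' k : ℕ, (10 : ℝ) ^ (-((2 * (k + 1) - 1).factorial : ℤ)))
    (hξ₂ : ξ₂ = ∑' k : ℕ, (10 : ℝ) ^ (-((2 * (k + 1)).factorial : ℤ))) :
    phiLow ξ₁ ξ₂ 1 = -2 ∧ phiLow ξ₁ ξ₂ 2 = -(1 / 2) ∧ phiLow ξ₁ ξ₂ 3 = 1 ∧
    phiUp ξ₁ ξ₂ 1 = -(1 / 2) ∧ phiUp ξ₁ ξ₂ 2 = 1 ∧ phiUp ξ₁ ξ₂ 3 = 1 := by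
  have hc : ∀ ε > 0, ∀ᶠ q : ℝ in atTop, Real.log 6 ≤ ε * q := fun ε hε =>
    (tendsto_id.const_mul_atTop hε).eventually_ge_atTop _
  have hbasic : ∀ᶠ q in atTop, 0 ≤ q ∧ -2 * q ≤ Lmin ξ₁ ξ₂ 1 q ∧
      Lmin ξ₁ ξ₂ 1 q ≤ Lmin ξ₁ ξ₂ 2 q ∧ Lmin ξ₁ ξ₂ 2 q ≤ Lmin ξ₁ ξ₂ 3 q ∧ Lmin ξ₁ ξ₂ 3 q ≤ q ∧
      -Real.log 6 ≤ Lmin ξ₁ ξ₂ 1 q + Lmin ξ₁ ξ₂ 2 q + Lmin ξ₁ ξ₂ 3 q := by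
    filter_upwards [eventually_ge_atTop 0] with q hq
    exact ⟨hq, neg_two_mul_le_Lmin_one hq, Lmin_le_succ hq (nonempty_dilationSet_two hq),
      Lmin_le_succ hq (nonempty_dilationSet_three hq), Lmin_three_le hq,
      neg_log_six_le_sum_Lmin hq⟩
  have hsum : ∀ ε > 0, ∀ᶠ q in atTop, Lmin ξ₁ ξ₂ 1 q + Lmin ξ₁ ξ₂ 2 q ≤ (-1 + ε) * q :=
    fun ε hε => eventually_Lmin_one_add_Lmin_two_le hξ₁ hξ₂ hε
  have hfreq₁ : ∀ ε > 0, ∃ᶠ q in atTop, Lmin ξ₁ ξ₂ 1 q ≤ (-2 + ε) * q :=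
    fun ε hε => frequently_Lmin_one_le hξ₁ hξ₂ hε
  have hfreq₂ : ∀ ε > 0, ∃ᶠ q in atTop, Lmin ξ₁ ξ₂ 2 q ≤ (-(1 / 2) + ε) * q :=
    fun ε hε => frequently_Lmin_two_le hξ₁ hξ₂ hε
  have hlow₃ : ∀ ε > 0, ∀ᶠ q in atTop, (1 - ε) * q ≤ Lmin ξ₁ ξ₂ 3 q := fun ε hε => by
    filter_upwards [hbasic, hc (ε / 2) (by positivity), hsum (ε / 2) (by positivity)]
      with q hb h1 h2
    linarith
  have hup : ∀ ε > 0, ∀ᶠ q in atTop, Lmin ξ₁ ξ₂ 2 q ≤ (1 + ε) * q ∧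
      Lmin ξ₁ ξ₂ 3 q ≤ (1 + ε) * q := fun ε hε => by
    filter_upwards [hbasic] with q hb
    have := mul_nonneg hε.le hb.1
    constructor <;> linarith
  refine ⟨liminf_div_eq ?_ ?_ hfreq₁, liminf_div_eq ?_ ?_ hfreq₂, liminf_div_eq ?_ hlow₃ ?_,
    limsup_div_eq ?_ ?_ ?_, limsup_div_eq ?_ ?_ ?_, limsup_div_eq ?_ ?_ ?_⟩
  · exact hbasic.mono fun q hb => hb.2.1
  · intro ε hε
    filter_upwards [hbasic] with q hb
    linarith [mul_nonneg hε.le hb.1]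
  · exact hbasic.mono fun q hb => by linarith
  · intro ε hε
    filter_upwards [hbasic, hc ε hε] with q hb h1
    linarith [mul_nonneg hε.le hb.1]
  · exact hbasic.mono fun q hb => by linarith
  · exact fun ε hε => (hup ε hε).frequently.mono fun q h => h.2
  · exact hbasic.mono fun q hb => by linarith
  · intro ε hε
    filter_upwards [hbasic, hsum ε hε] with q hb h1
    linarith [mul_nonneg hε.le hb.1]
  · intro ε hε
    refine ((hfreq₂ (ε / 2) (by positivity)).and_eventually
      (hbasic.and (hc (ε / 2) (by positivity)))).mono ?_
    rintro q ⟨h1, hb, h2⟩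
    linarith
  · exact hbasic.mono fun q hb => by linarith
  · exact fun ε hε => (hup ε hε).mono fun q h => h.1
  · intro ε hε
    refine ((hfreq₁ (ε / 2) (by positivity)).and_eventually
      (hbasic.and (hc (ε / 2) (by positivity)))).mono ?_
    rintro q ⟨h1, hb, h2⟩
    linarith
  · exact hbasic.mono fun q hb => hb.2.2.2.2.1
  · exact fun ε hε => (hup ε hε).mono fun q h => h.2
  · exact fun ε hε => (hlow₃ ε hε).frequently
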